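/- Let a, b > 0 and 0 < γ < γ̄, and let e : [0,∞) → (0,1] be measurable with |e(s) − 1 + a s^γ| ≤ b s^{γ̄} for all s ≥ 0, and set γ̃ := min(γ, γ̄ − γ). Then there exists a constant C > 0 such that for every λ ∈ (0,1] and all measurable f, g : ℝ³ → ℝ with N(f) := ∫_{ℝ³} |f(v)| (1+|v|²)^{(3+γ+γ̄)/2} dv < ∞ and N(g) < ∞, one has |I_λ(f,g) − I₀(f,g)| ≤ C λ^{γ̃} N(f) N(g), where I_λ(f,g) := ∫∫ f(v_*) g(v) ζ_λ(|v−v_*|²) dv_* dv and I₀(f,g) := ∫∫ f(v_*) g(v) ζ₀(|v−v_*|²) dv_* dv. -/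

import Mathlib

open MeasureTheory

/-- `ψ_e(r) = 4π r^{3/2} ∫₀¹ (1 - e(√r z)²) z³ dz`. -/
noncomputable def psiE (e : ℝ → ℝ) (r : ℝ) : ℝ :=
  4 * Real.pi * r ^ ((3:ℝ)/2) * ∫ z in (0:ℝ)..1, (1 - (e (Real.sqrt r * z)) ^ 2) * z ^ 3

/-- `ζ_λ(ρ) = λ^{-3-γ} ψ_e(λ² ρ)`. -/
noncomputable def zetaLam (e : ℝ → ℝ) (γ lam ρ : ℝ) : ℝ :=
  lam ^ (-(3 + γ)) * psiE e (lam ^ 2 * ρ)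

/-- `ζ₀(ρ) = (8πa/(4+γ)) ρ^{(3+γ)/2}`. -/
noncomputable def zeta0 (a γ ρ : ℝ) : ℝ :=
  (8 * Real.pi * a / (4 + γ)) * ρ ^ ((3 + γ) / 2)

/-- The moment `N(f) = ∫ |f(v)| (1+|v|²)^{(3+γ+γ̄)/2} dv`. -/
noncomputable def momN (γ γbar : ℝ) (f : EuclideanSpace ℝ (Fin 3) → ℝ) : ℝ :=
  ∫ v : EuclideanSpace ℝ (Fin 3), |f v| * (1 + ‖v‖ ^ 2) ^ ((3 + γ + γbar) / 2)

lemma rpow_mul_le_of_le {lam t ρ p m M : ℝ} (hlam : lam ∈ Set.Ioc (0 : ℝ) 1) (ht : 0 ≤ t)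
    (htρ : t ^ 2 ≤ ρ) (hm : m ≤ p) (hp : 0 ≤ p) (hM : p ≤ M) :
    (lam * t) ^ p ≤ lam ^ m * (1 + ρ) ^ (M / 2) := by
  have hρ : 0 ≤ ρ := (sq_nonneg t).trans htρ
  have h1 : lam ^ p ≤ lam ^ m := Real.rpow_le_rpow_of_exponent_ge hlam.1 hlam.2 hm
  have h2 : t ^ p ≤ (1 + ρ) ^ (M / 2) := by
    have : t ^ p = (t ^ 2) ^ (p / 2) := by
      rw [← Real.rpow_natCast, ← Real.rpow_mul ht]
      congr 1
      push_cast
      ring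
    rw [this]
    calc (t ^ 2) ^ (p / 2) ≤ (1 + ρ) ^ (p / 2) :=
          Real.rpow_le_rpow (sq_nonneg t) (by linarith) (by linarith)
      _ ≤ (1 + ρ) ^ (M / 2) := Real.rpow_le_rpow_of_exponent_le (by linarith) (by linarith)
  rw [Real.mul_rpow hlam.1.le ht]
  exact mul_le_mul h1 h2 (Real.rpow_nonneg ht _) (Real.rpow_nonneg hlam.1.le _)

lemma abs_one_sub_sq_sub_le {a b x y u : ℝ} (ha : 0 < a) (hx : 0 ≤ x) (hy : 0 ≤ y)
    (hb : 0 < b) (hu : u ∈ Set.Ioc (0 : ℝ) 1) (h : |u - 1 + a * x| ≤ b * y) :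
    |1 - u ^ 2 - 2 * a * x| ≤ 3 * b * y + a ^ 2 * (x * x) + a * b * (x * y) := by
  obtain ⟨h1, h2⟩ := abs_le.1 h
  obtain ⟨hu0, hu1⟩ := hu
  have hax : 0 ≤ a * x := by positivity
  have hby : 0 ≤ b * y := by positivity
  have hsq : (1 - u) ^ 2 ≤ b * y + a * x * (a * x + b * y) := by
    nlinarith [mul_nonneg hax (show 0 ≤ a * x + b * y - (1 - u) by linarith),
      mul_nonneg hby hu0.le, mul_nonneg (show 0 ≤ 1 - u by linarith)
        (show 0 ≤ a * x + b * y - (1 - u) by linarith)]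
  rw [abs_le]
  constructor <;> nlinarith [sq_nonneg (1 - u)]

lemma abs_zetaLam_sub_zeta0_le {a b γ γbar : ℝ} (ha : 0 < a) (hb : 0 < b) (hγ : 0 < γ)
    (hγbar : γ < γbar) {e : ℝ → ℝ} (he_meas : Measurable e)
    (he_range : ∀ s : ℝ, 0 ≤ s → e s ∈ Set.Ioc (0:ℝ) 1)
    (he : ∀ s : ℝ, 0 ≤ s → |e s - 1 + a * s ^ γ| ≤ b * s ^ γbar)
    {lam ρ : ℝ} (hlam : lam ∈ Set.Ioc (0 : ℝ) 1) (hρ : 0 ≤ ρ) :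
    |zetaLam e γ lam ρ - zeta0 a γ ρ| ≤
      4 * Real.pi * (3 * b + a ^ 2 + a * b) * lam ^ (min γ (γbar - γ)) *
        (1 + ρ) ^ ((3 + γ + γbar) / 2) := by
  have hl0 := hlam.1
  have hsqrt : Real.sqrt (lam ^ 2 * ρ) = lam * Real.sqrt ρ := by
    rw [Real.sqrt_mul (sq_nonneg _), Real.sqrt_sq hl0.le]
  have hpow : (lam ^ 2 * ρ) ^ ((3 : ℝ) / 2) = lam ^ (3 : ℝ) * ρ ^ ((3 : ℝ) / 2) := by
    rw [Real.mul_rpow (sq_nonneg _) hρ, ← Real.rpow_natCast, ← Real.rpow_mul hl0.le]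
    norm_num
  have hint1 : IntervalIntegrable
      (fun z => (1 - (e (lam * Real.sqrt ρ * z)) ^ 2) * z ^ 3) volume 0 1 := by
    rw [intervalIntegrable_iff, Set.uIoc_of_le zero_le_one]
    refine Measure.integrableOn_of_bounded (M := 1) (by simp)
      (by fun_prop) ?_
    refine (ae_restrict_mem measurableSet_Ioc).mono fun z hz => ?_
    obtain ⟨h0, h1⟩ := he_range (lam * Real.sqrt ρ * z)
      (mul_nonneg (by positivity) hz.1.le)
    have h3 : z ^ 3 ≤ 1 := pow_le_one₀ hz.1.le hz.2
    have h4 : 0 ≤ z ^ 3 := pow_nonneg hz.1.le 3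
    have h5 : e (lam * Real.sqrt ρ * z) ^ 2 ≤ 1 := pow_le_one₀ h0.le h1
    rw [Real.norm_eq_abs, abs_of_nonneg (mul_nonneg (by linarith) h4)]
    exact mul_le_one₀ (by nlinarith) h4 h3
  have hint2 : IntervalIntegrable
      (fun z : ℝ => 2 * a * (lam * Real.sqrt ρ * z) ^ γ * z ^ 3) volume 0 1 := by
    apply Continuous.intervalIntegrable
    have : Continuous fun z : ℝ => (lam * Real.sqrt ρ * z) ^ γ :=
      (continuous_const.mul continuous_id).rpow_const fun _ => Or.inr hγ.le
    fun_prop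
  have hval : ∫ z in (0 : ℝ)..1, 2 * a * (lam * Real.sqrt ρ * z) ^ γ * z ^ 3 =
      2 * a * lam ^ γ * ρ ^ (γ / 2) / (4 + γ) := by
    have : ∫ z in (0 : ℝ)..1, 2 * a * (lam * Real.sqrt ρ * z) ^ γ * z ^ 3 =
        ∫ z in (0 : ℝ)..1, (2 * a * lam ^ γ * ρ ^ (γ / 2)) * z ^ (γ + 3) := by
      refine intervalIntegral.integral_congr fun z hz => ?_
      rw [Set.uIcc_of_le zero_le_one] at hz
      have hz3 : z ^ (γ + 3) = z ^ γ * z ^ 3 := by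
        rw [Real.rpow_add_of_nonneg hz.1 hγ.le (by norm_num)]
        norm_cast
      rw [Real.mul_rpow (by positivity) hz.1, Real.mul_rpow hl0.le (Real.sqrt_nonneg _),
        Real.sqrt_eq_rpow, ← Real.rpow_mul hρ, hz3]
      ring_nf
    rw [this, intervalIntegral.integral_const_mul, integral_rpow (Or.inl (by linarith)),
      Real.one_rpow, Real.zero_rpow (by linarith)]
    field_simp
    ring
  set q := (γ + γbar) / 2 with hq
  set K := 3 * b + a ^ 2 + a * b with hK
  have hbound : |(∫ z in (0 : ℝ)..1, (1 - (e (lam * Real.sqrt ρ * z)) ^ 2) * z ^ 3) -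
      ∫ z in (0 : ℝ)..1, 2 * a * (lam * Real.sqrt ρ * z) ^ γ * z ^ 3| ≤
      K * (lam ^ (γ + min γ (γbar - γ)) * (1 + ρ) ^ q) := by
    rw [← intervalIntegral.integral_sub hint1 hint2, ← Real.norm_eq_abs, show K * (lam ^ (γ + min γ (γbar - γ)) * (1 + ρ) ^ q) =
      K * (lam ^ (γ + min γ (γbar - γ)) * (1 + ρ) ^ q) * |(1 : ℝ) - 0| by simp]
    refine intervalIntegral.norm_integral_le_of_norm_le_const fun z hz => ?_
    rw [Set.uIoc_of_le zero_le_one] at hz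
    set t := Real.sqrt ρ * z with ht
    have ht0 : 0 ≤ t := mul_nonneg (Real.sqrt_nonneg _) hz.1.le
    have htρ : t ^ 2 ≤ ρ := by
      rw [ht, mul_pow, Real.sq_sqrt hρ]
      exact mul_le_of_le_one_right hρ (pow_le_one₀ hz.1.le hz.2)
    have hs : lam * Real.sqrt ρ * z = lam * t := by rw [ht, mul_assoc]
    have hs0 : 0 ≤ lam * t := mul_nonneg hl0.le ht0
    rw [hs]
    have key := abs_one_sub_sq_sub_le ha (Real.rpow_nonneg hs0 γ) (Real.rpow_nonneg hs0 γbar) hb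
      (he_range _ hs0) (he _ hs0)
    rw [← Real.rpow_add_of_nonneg hs0 hγ.le hγ.le,
      ← Real.rpow_add_of_nonneg hs0 hγ.le (hγ.trans hγbar).le] at key
    have hmin1 := min_le_left γ (γbar - γ)
    have hmin2 := min_le_right γ (γbar - γ)
    have b1 := rpow_mul_le_of_le (p := γbar) (m := γ + min γ (γbar - γ)) (M := γ + γbar)
      hlam ht0 htρ (by linarith) (by linarith) (by linarith)
    have b2 := rpow_mul_le_of_le (p := γ + γ) (m := γ + min γ (γbar - γ)) (M := γ + γbar)
      hlam ht0 htρ (by linarith) (by linarith) (by linarith)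
    have b3 := rpow_mul_le_of_le (p := γ + γbar) (m := γ + min γ (γbar - γ)) (M := γ + γbar)
      hlam ht0 htρ (by linarith) (by linarith) (by linarith)
    rw [Real.norm_eq_abs, ← sub_mul, abs_mul, abs_of_nonneg (pow_nonneg hz.1.le 3)]
    refine (mul_le_of_le_one_right (abs_nonneg _) (pow_le_one₀ hz.1.le hz.2)).trans
      (key.trans ?_)
    rw [hK, add_mul, add_mul]
    gcongr
  have hz0 : zeta0 a γ ρ = 4 * Real.pi * lam ^ (-γ) * ρ ^ ((3 : ℝ) / 2) *
      (2 * a * lam ^ γ * ρ ^ (γ / 2) / (4 + γ)) := by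
    have h1 : ρ ^ ((3 + γ) / 2) = ρ ^ ((3 : ℝ) / 2) * ρ ^ (γ / 2) := by
      rw [← Real.rpow_add_of_nonneg hρ (by norm_num) (by linarith)]
      ring_nf
    have h2 : lam ^ (-γ) * lam ^ γ = 1 := by
      rw [← Real.rpow_add hl0]; simp
    rw [zeta0, h1]
    linear_combination (-(8 * Real.pi * a / (4 + γ)) * ρ ^ ((3 : ℝ) / 2) * ρ ^ (γ / 2)) * h2
  have hzl : zetaLam e γ lam ρ = 4 * Real.pi * lam ^ (-γ) * ρ ^ ((3 : ℝ) / 2) *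
      ∫ z in (0 : ℝ)..1, (1 - (e (lam * Real.sqrt ρ * z)) ^ 2) * z ^ 3 := by
    have h2 : lam ^ (-γ) = lam ^ (-(3 + γ)) * lam ^ (3 : ℝ) := by
      rw [← Real.rpow_add hl0]; ring_nf
    rw [zetaLam, psiE, hsqrt, hpow, h2]
    ring
  rw [hzl, hz0, ← hval, ← mul_sub, abs_mul, abs_of_nonneg (by positivity)]
  have hρ32 : ρ ^ ((3 : ℝ) / 2) ≤ (1 + ρ) ^ ((3 : ℝ) / 2) :=
    Real.rpow_le_rpow hρ (by linarith) (by norm_num)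
  have hq' : (1 + ρ) ^ ((3 + γ + γbar) / 2) = (1 + ρ) ^ ((3 : ℝ) / 2) * (1 + ρ) ^ q := by
    rw [← Real.rpow_add (by linarith)]
    congr 1
    rw [hq]
    ring
  have hl : lam ^ (min γ (γbar - γ)) = lam ^ (-γ) * lam ^ (γ + min γ (γbar - γ)) := by
    rw [← Real.rpow_add hl0]; ring_nf
  have hK0 : 0 ≤ K := by positivity
  calc 4 * Real.pi * lam ^ (-γ) * ρ ^ ((3 : ℝ) / 2) * _
      ≤ 4 * Real.pi * lam ^ (-γ) * (1 + ρ) ^ ((3 : ℝ) / 2) *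
        (K * (lam ^ (γ + min γ (γbar - γ)) * (1 + ρ) ^ q)) := by gcongr
    _ = _ := by rw [hq', hl]; ring

lemma measurable_psiE {e : ℝ → ℝ} (he : Measurable e) : Measurable (psiE e) := by
  unfold psiE
  refine (by fun_prop : Measurable fun r : ℝ => 4 * Real.pi * r ^ ((3 : ℝ) / 2)).mul ?_
  simp_rw [intervalIntegral.integral_of_le (zero_le_one' ℝ)]
  have : StronglyMeasurable (Function.uncurry fun r z : ℝ =>
      (1 - (e (Real.sqrt r * z)) ^ 2) * z ^ 3) := by
    apply Measurable.stronglyMeasurable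
    unfold Function.uncurry
    fun_prop
  exact this.integral_prod_right.measurable

lemma one_add_norm_sub_sq_rpow_le {E : Type*} [SeminormedAddCommGroup E] (v w : E) {q : ℝ}
    (hq : 0 ≤ q) :
    (1 + ‖v - w‖ ^ 2) ^ q ≤ 2 ^ q * ((1 + ‖v‖ ^ 2) ^ q * (1 + ‖w‖ ^ 2) ^ q) := by
  rw [← Real.mul_rpow (by positivity) (by positivity),
    ← Real.mul_rpow (by positivity) (by positivity)]
  refine Real.rpow_le_rpow (by positivity) ?_ hq
  have h := norm_sub_le v w
  nlinarith [sq_nonneg (‖v‖ - ‖w‖), norm_nonneg (v - w), norm_nonneg v, norm_nonneg w,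
    mul_nonneg (sq_nonneg ‖v‖) (sq_nonneg ‖w‖)]

lemma abs_mul_mul_comp_norm_sub_le {E : Type*} [SeminormedAddCommGroup E] {f g : E → ℝ}
    {k : ℝ → ℝ} {B q : ℝ} (hB : 0 ≤ B) (hq : 0 ≤ q)
    (hkB : ∀ ρ, 0 ≤ ρ → |k ρ| ≤ B * (1 + ρ) ^ q) (v w : E) :
    |f w * g v * k (‖v - w‖ ^ 2)| ≤
      B * 2 ^ q * ((|g v| * (1 + ‖v‖ ^ 2) ^ q) * (|f w| * (1 + ‖w‖ ^ 2) ^ q)) := by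
  have h1 : |k (‖v - w‖ ^ 2)| ≤ B * (2 ^ q * ((1 + ‖v‖ ^ 2) ^ q * (1 + ‖w‖ ^ 2) ^ q)) :=
    (hkB _ (sq_nonneg _)).trans
      (mul_le_mul_of_nonneg_left (one_add_norm_sub_sq_rpow_le v w hq) hB)
  rw [abs_mul, abs_mul]
  calc |f w| * |g v| * |k (‖v - w‖ ^ 2)| ≤ |f w| * |g v| *
        (B * (2 ^ q * ((1 + ‖v‖ ^ 2) ^ q * (1 + ‖w‖ ^ 2) ^ q))) := by gcongr
    _ = _ := by ring

lemma integrable_mul_mul_comp_norm_sub {f g : EuclideanSpace ℝ (Fin 3) → ℝ} {k : ℝ → ℝ}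
    {B q : ℝ} (hB : 0 ≤ B) (hq : 0 ≤ q) (hf : Measurable f) (hg : Measurable g)
    (hk : Measurable k) (hkB : ∀ ρ, 0 ≤ ρ → |k ρ| ≤ B * (1 + ρ) ^ q)
    (hfi : Integrable fun v => |f v| * (1 + ‖v‖ ^ 2) ^ q)
    (hgi : Integrable fun v => |g v| * (1 + ‖v‖ ^ 2) ^ q) :
    Integrable (fun p : EuclideanSpace ℝ (Fin 3) × EuclideanSpace ℝ (Fin 3) =>
      f p.2 * g p.1 * k (‖p.1 - p.2‖ ^ 2)) (volume.prod volume) := by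
  refine Integrable.mono' ((hgi.mul_prod hfi).const_mul (B * 2 ^ q)) ?_
    (Filter.Eventually.of_forall fun p => ?_)
  · exact Measurable.aestronglyMeasurable (by fun_prop)
  · exact abs_mul_mul_comp_norm_sub_le hB hq hkB p.1 p.2

/-- Quantitative convergence `I_λ(f,g) → I₀(f,g)`: with
`γ̃ = min(γ, γ̄-γ)`, there is `C > 0` such that for all `λ ∈ (0,1]` and all measurable
`f, g` with finite moments `N(f), N(g)`, one has
`|I_λ(f,g) - I₀(f,g)| ≤ C λ^{γ̃} N(f) N(g)`, where
`I_λ(f,g) = ∫∫ f(v_*) g(v) ζ_λ(|v-v_*|²) dv_* dv` and similarly for `I₀` with `ζ₀`. -/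
theorem stmt11
    (a b γ γbar : ℝ) (ha : 0 < a) (hb : 0 < b) (hγ : 0 < γ) (hγbar : γ < γbar)
    (e : ℝ → ℝ) (he_meas : Measurable e)
    (he_range : ∀ s : ℝ, 0 ≤ s → e s ∈ Set.Ioc (0:ℝ) 1)
    (he : ∀ s : ℝ, 0 ≤ s → |e s - 1 + a * s ^ γ| ≤ b * s ^ γbar) :
    ∃ C : ℝ, 0 < C ∧ ∀ lam : ℝ, lam ∈ Set.Ioc (0:ℝ) 1 →
      ∀ f g : EuclideanSpace ℝ (Fin 3) → ℝ, Measurable f → Measurable g →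
        Integrable (fun v : EuclideanSpace ℝ (Fin 3) =>
          |f v| * (1 + ‖v‖ ^ 2) ^ ((3 + γ + γbar) / 2)) →
        Integrable (fun v : EuclideanSpace ℝ (Fin 3) =>
          |g v| * (1 + ‖v‖ ^ 2) ^ ((3 + γ + γbar) / 2)) →
        |(∫ v : EuclideanSpace ℝ (Fin 3), ∫ vs : EuclideanSpace ℝ (Fin 3),
              f vs * g v * zetaLam e γ lam (‖v - vs‖ ^ 2)) -
            ∫ v : EuclideanSpace ℝ (Fin 3), ∫ vs : EuclideanSpace ℝ (Fin 3),
              f vs * g v * zeta0 a γ (‖v - vs‖ ^ 2)| ≤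
          C * lam ^ (min γ (γbar - γ)) * momN γ γbar f * momN γ γbar g := by
  have hK : 0 < 4 * Real.pi * (3 * b + a ^ 2 + a * b) := by positivity
  have hq : 0 ≤ (3 + γ + γbar) / 2 := by linarith
  refine ⟨4 * Real.pi * (3 * b + a ^ 2 + a * b) * 2 ^ ((3 + γ + γbar) / 2), by positivity, ?_⟩
  intro lam hlam f g hf hg hfi hgi
  have hl0 := hlam.1
  have hdiff : ∀ ρ, 0 ≤ ρ → |zetaLam e γ lam ρ - zeta0 a γ ρ| ≤ _ := fun ρ hρ =>
    abs_zetaLam_sub_zeta0_le ha hb hγ hγbar he_meas he_range he hlam hρ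
  have hc : 0 ≤ 8 * Real.pi * a / (4 + γ) := by positivity
  have hz0 : ∀ ρ, 0 ≤ ρ → |zeta0 a γ ρ| ≤
      8 * Real.pi * a / (4 + γ) * (1 + ρ) ^ ((3 + γ + γbar) / 2) := by
    intro ρ hρ
    rw [zeta0, abs_of_nonneg (by positivity)]
    refine mul_le_mul_of_nonneg_left ?_ hc
    exact (Real.rpow_le_rpow hρ (by linarith) (by linarith)).trans
      (Real.rpow_le_rpow_of_exponent_le (by linarith) (by linarith))
  have hzl : ∀ ρ, 0 ≤ ρ → |zetaLam e γ lam ρ| ≤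
      (4 * Real.pi * (3 * b + a ^ 2 + a * b) * lam ^ (min γ (γbar - γ)) +
        8 * Real.pi * a / (4 + γ)) * (1 + ρ) ^ ((3 + γ + γbar) / 2) := by
    intro ρ hρ
    rw [add_mul]
    calc |zetaLam e γ lam ρ| = |(zetaLam e γ lam ρ - zeta0 a γ ρ) + zeta0 a γ ρ| := by
          rw [sub_add_cancel]
      _ ≤ _ := (abs_add_le _ _).trans (add_le_add (hdiff ρ hρ) (hz0 ρ hρ))
  have hm0 : Measurable (zeta0 a γ) := by unfold zeta0; fun_prop
  have hml : Measurable (zetaLam e γ lam) := by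
    unfold zetaLam
    exact ((measurable_psiE he_meas).comp (measurable_id.const_mul _)).const_mul _
  have hI0 := integrable_mul_mul_comp_norm_sub hc hq hf hg hm0 hz0 hfi hgi
  have hIl := integrable_mul_mul_comp_norm_sub (by positivity) hq hf hg hml hzl hfi hgi
  rw [← integral_prod (μ := volume) (ν := volume) _ hIl,
    ← integral_prod (μ := volume) (ν := volume) _ hI0, ← integral_sub hIl hI0,
    ← Real.norm_eq_abs]
  have hprod := integral_prod_mul (μ := volume) (ν := volume)
    (fun v : EuclideanSpace ℝ (Fin 3) => |g v| * (1 + ‖v‖ ^ 2) ^ ((3 + γ + γbar) / 2))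
    (fun v : EuclideanSpace ℝ (Fin 3) => |f v| * (1 + ‖v‖ ^ 2) ^ ((3 + γ + γbar) / 2))
  refine (norm_integral_le_of_norm_le ((hgi.mul_prod hfi).const_mul
    (4 * Real.pi * (3 * b + a ^ 2 + a * b) * lam ^ (min γ (γbar - γ)) *
      2 ^ ((3 + γ + γbar) / 2))) (Filter.Eventually.of_forall fun p => ?_)).trans (le_of_eq ?_)
  · rw [← mul_sub]
    exact abs_mul_mul_comp_norm_sub_le (k := fun ρ => zetaLam e γ lam ρ - zeta0 a γ ρ)
      (by positivity) hq hdiff p.1 p.2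
  · rw [integral_const_mul, hprod, momN, momN]
    ring
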